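/- arXiv:1004.3889 — 9 statements merged into one kernel-verified Lean document; each statement's English description precedes it below -/
import Mathlib

section
/- Let α : ℝ → ℝ be a continuous function and set χ(u) = ∫₀ᵘ cos α(τ) dτ, φ(u) = ∫₀ᵘ sin α(τ) e^{χ(τ)} dτ, and F(u,v) = (v, φ(u), χ(u)). Then with respect to the Sol metric g at the point F(u,v): the tangent vector ∂F/∂u = (0, sin α(u) e^{χ(u)}, cos α(u)) is a unit vector, ∂F/∂u and ∂F/∂v = (1,0,0) are orthogonal with g(∂F/∂v, ∂F/∂v) = e^{2χ(u)}, and the vector N(u,v) = (0, -cos α(u) e^{χ(u)}, sin α(u)) is a unit vector orthogonal to both ∂F/∂u and ∂F/∂v which satisfies g(N, e₁(F(u,v))) = 0. Hence F parametrizes a surface in Sol₃ whose unit normal makes constant angle π/2 with e₁. -/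
open Real

/-- The Sol₃ metric on ℝ³: at `p = (p₁,p₂,p₃)`,
`g_p(v,w) = e^{2p₃}v₁w₁ + e^{-2p₃}v₂w₂ + v₃w₃`. -/
noncomputable def solMetric (p v w : ℝ × ℝ × ℝ) : ℝ :=
  Real.exp (2 * p.2.2) * v.1 * w.1 + Real.exp (-(2 * p.2.2)) * v.2.1 * w.2.1 + v.2.2 * w.2.2

/-- The frame field `e₁(p) = (e^{-z},0,0)` at `p = (x,y,z)`. -/
noncomputable def solE1 (p : ℝ × ℝ × ℝ) : ℝ × ℝ × ℝ := (Real.exp (-p.2.2), 0, 0)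

/-- For continuous `α : ℝ → ℝ`, set `χ(u) = ∫₀ᵘ cos α(τ) dτ`,
`φ(u) = ∫₀ᵘ sin α(τ) e^{χ(τ)} dτ`, and `F(u,v) = (v, φ(u), χ(u))`. Then, w.r.t. the Sol
metric at `F(u,v)`: `∂F/∂u = (0, sin α(u) e^{χ(u)}, cos α(u))` is a unit vector,
`∂F/∂u ⟂ ∂F/∂v = (1,0,0)` with `g(∂F/∂v, ∂F/∂v) = e^{2χ(u)}`, and
`N(u,v) = (0, -cos α(u) e^{χ(u)}, sin α(u))` is a unit vector orthogonal to both partial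
derivatives with `g(N, e₁(F(u,v))) = 0`. Hence `F` parametrizes a surface in Sol₃ whose
unit normal makes constant angle `π/2` with `e₁`. -/
theorem sol_constant_angle_pi_div_two (α : ℝ → ℝ) (hα : Continuous α)
    (χ φ : ℝ → ℝ)
    (hχ : ∀ u, χ u = ∫ τ in (0:ℝ)..u, Real.cos (α τ))
    (hφ : ∀ u, φ u = ∫ τ in (0:ℝ)..u, Real.sin (α τ) * Real.exp (χ τ))
    (F : ℝ → ℝ → ℝ × ℝ × ℝ) (hF : ∀ u v, F u v = (v, φ u, χ u))
    (Fu Fv N : ℝ → ℝ → ℝ × ℝ × ℝ)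
    (hFu : ∀ u v, Fu u v = (0, Real.sin (α u) * Real.exp (χ u), Real.cos (α u)))
    (hFv : ∀ u v, Fv u v = (1, 0, 0))
    (hN : ∀ u v, N u v = (0, -Real.cos (α u) * Real.exp (χ u), Real.sin (α u))) :
    ∀ u v : ℝ,
      HasDerivAt (fun t => F t v) (Fu u v) u ∧
      HasDerivAt (fun t => F u t) (Fv u v) v ∧
      solMetric (F u v) (Fu u v) (Fu u v) = 1 ∧
      solMetric (F u v) (Fu u v) (Fv u v) = 0 ∧
      solMetric (F u v) (Fv u v) (Fv u v) = Real.exp (2 * χ u) ∧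
      solMetric (F u v) (N u v) (N u v) = 1 ∧
      solMetric (F u v) (N u v) (Fu u v) = 0 ∧
      solMetric (F u v) (N u v) (Fv u v) = 0 ∧
      solMetric (F u v) (N u v) (solE1 (F u v)) = 0 := by
  have hcos : Continuous fun τ => Real.cos (α τ) := Real.continuous_cos.comp hα
  have hχ' : ∀ u, HasDerivAt χ (Real.cos (α u)) u := by
    rw [funext hχ]
    exact fun u => hcos.integral_hasStrictDerivAt 0 u |>.hasDerivAt
  have hχc : Continuous χ := continuous_iff_continuousAt.2 fun u => (hχ' u).continuousAt
  have hφ' : ∀ u, HasDerivAt φ (Real.sin (α u) * Real.exp (χ u)) u := by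
    have hc : Continuous fun τ => Real.sin (α τ) * Real.exp (χ τ) := by fun_prop
    rw [funext hφ]
    exact fun u => hc.integral_hasStrictDerivAt 0 u |>.hasDerivAt
  intro u v
  have hexp : Real.exp (-(2 * χ u)) * Real.exp (χ u) ^ 2 = 1 := by
    rw [← Real.exp_nat_mul, ← Real.exp_add]
    simp
  have htrig := Real.sin_sq_add_cos_sq (α u)
  simp only [hF, hFu, hFv, hN, solMetric, solE1]
  refine ⟨(hasDerivAt_const u v).prodMk ((hφ' u).prodMk (hχ' u)),
    (hasDerivAt_id v).prodMk ((hasDerivAt_const v (φ u)).prodMk (hasDerivAt_const v (χ u))),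
    ?_, by ring, by ring, ?_, ?_, by ring, by ring⟩
  · linear_combination Real.sin (α u) ^ 2 * hexp + htrig
  · linear_combination Real.cos (α u) ^ 2 * hexp + htrig
  · linear_combination -(Real.sin (α u) * Real.cos (α u)) * hexp
end

section
/- Let θ ∈ (0, π/2) and define F(u,v) = (tan θ · e^{u cos θ}, v, -u cos θ). Then with respect to the Sol metric g at the point F(u,v): the tangent vector ∂F/∂u = (sin θ · e^{u cos θ}, 0, -cos θ) is a unit vector orthogonal to ∂F/∂v = (0,1,0), and the vector N(u,v) = (cos θ · e^{u cos θ}, 0, sin θ) is a unit vector orthogonal to both ∂F/∂u and ∂F/∂v which satisfies g(N, e₁(F(u,v))) = cos θ. Hence F parametrizes a constant angle surface in Sol₃ with angle θ. -/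
open Real

/-- For `θ ∈ (0, π/2)` and `F(u,v) = (tan θ · e^{u cos θ}, v, -u cos θ)`, w.r.t. the Sol
metric at `F(u,v)`: `∂F/∂u = (sin θ · e^{u cos θ}, 0, -cos θ)` is a unit vector
orthogonal to `∂F/∂v = (0,1,0)`, and `N(u,v) = (cos θ · e^{u cos θ}, 0, sin θ)` is a unit
vector orthogonal to both partial derivatives with `g(N, e₁(F(u,v))) = cos θ`. Hence `F`
parametrizes a constant angle surface in Sol₃ with angle `θ`. -/
theorem sol_constant_angle_surface (θ : ℝ) (hθ : θ ∈ Set.Ioo 0 (Real.pi / 2))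
    (F : ℝ → ℝ → ℝ × ℝ × ℝ)
    (hF : ∀ u v, F u v =
      (Real.tan θ * Real.exp (u * Real.cos θ), v, -(u * Real.cos θ)))
    (Fu Fv N : ℝ → ℝ → ℝ × ℝ × ℝ)
    (hFu : ∀ u v, Fu u v =
      (Real.sin θ * Real.exp (u * Real.cos θ), 0, -Real.cos θ))
    (hFv : ∀ u v, Fv u v = (0, 1, 0))
    (hN : ∀ u v, N u v =
      (Real.cos θ * Real.exp (u * Real.cos θ), 0, Real.sin θ)) :
    ∀ u v : ℝ,
      HasDerivAt (fun t => F t v) (Fu u v) u ∧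
      HasDerivAt (fun t => F u t) (Fv u v) v ∧
      solMetric (F u v) (Fu u v) (Fu u v) = 1 ∧
      solMetric (F u v) (Fu u v) (Fv u v) = 0 ∧
      solMetric (F u v) (N u v) (N u v) = 1 ∧
      solMetric (F u v) (N u v) (Fu u v) = 0 ∧
      solMetric (F u v) (N u v) (Fv u v) = 0 ∧
      solMetric (F u v) (N u v) (solE1 (F u v)) = Real.cos θ := by
  intro u v
  have hcos : Real.cos θ ≠ 0 :=
    (Real.cos_pos_of_mem_Ioo ⟨by linarith [hθ.1, Real.pi_pos], hθ.2⟩).ne'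
  have hexp : Real.exp (2 * -(u * Real.cos θ)) * Real.exp (u * Real.cos θ) *
      Real.exp (u * Real.cos θ) = 1 := by
    rw [← Real.exp_add, ← Real.exp_add, Real.exp_eq_one_iff]
    ring
  have hlin : HasDerivAt (fun t : ℝ => t * Real.cos θ) (Real.cos θ) u := by
    simpa using (hasDerivAt_id u).mul_const (Real.cos θ)
  simp only [hF, hFu, hFv, hN, solMetric, solE1, neg_neg]
  refine ⟨?_, ?_, ?_, by ring, ?_, ?_, by ring, ?_⟩
  · refine HasDerivAt.prodMk ?_ ((hasDerivAt_const u v).prodMk hlin.neg)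
    refine (hlin.exp.const_mul (Real.tan θ)).congr_deriv ?_
    rw [← Real.tan_mul_cos hcos]
    ring
  · exact (hasDerivAt_const v _).prodMk ((hasDerivAt_id v).prodMk (hasDerivAt_const v _))
  · linear_combination Real.sin θ ^ 2 * hexp + Real.sin_sq_add_cos_sq θ
  · linear_combination Real.cos θ ^ 2 * hexp + Real.sin_sq_add_cos_sq θ
  · linear_combination Real.cos θ * Real.sin θ * hexp
  · linear_combination Real.cos θ * hexp
end

section
/- Let θ ∈ (0, π/2) and F(u,v) = (tan θ · e^{u cos θ}, v, -u cos θ). The first fundamental form of F with respect to the Sol metric has coefficients E(u,v) = g(∂F/∂u, ∂F/∂u) = 1, F(u,v) = g(∂F/∂u, ∂F/∂v) = 0, and G(u,v) = g(∂F/∂v, ∂F/∂v) = e^{2u cos θ}; consequently the Gaussian curvature, given for a metric du² + G dv² by K = -(∂²(√G)/∂u²)/√G, equals the negative constant -cos²θ. -/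
open Real

theorem hasDerivAt_exp_mul_const (c u : ℝ) :
    HasDerivAt (fun t : ℝ => Real.exp (t * c)) (c * Real.exp (u * c)) u := by
  simpa [mul_comm] using ((hasDerivAt_id u).mul_const c).exp

theorem sqrt_exp_two_mul_mul (t c : ℝ) :
    Real.sqrt (Real.exp (2 * t * c)) = Real.exp (t * c) := by
  rw [← Real.exp_half]
  ring_nf

/-- For `θ ∈ (0, π/2)` and `F(u,v) = (tan θ · e^{u cos θ}, v, -u cos θ)`, the first
fundamental form w.r.t. the Sol metric has coefficients `E = 1`, `F = 0`,
`G = e^{2u cos θ}`; consequently the Gaussian curvature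
`K = -(∂²(√G)/∂u²)/√G` equals the negative constant `-cos²θ`. -/
theorem sol_constant_angle_surface_curvature (θ : ℝ) (hθ : θ ∈ Set.Ioo 0 (Real.pi / 2))
    (F : ℝ → ℝ → ℝ × ℝ × ℝ)
    (hF : ∀ u v, F u v =
      (Real.tan θ * Real.exp (u * Real.cos θ), v, -(u * Real.cos θ)))
    (Fu Fv : ℝ → ℝ → ℝ × ℝ × ℝ)
    (hFu : ∀ u v, HasDerivAt (fun t => F t v) (Fu u v) u)
    (hFv : ∀ u v, HasDerivAt (fun t => F u t) (Fv u v) v) :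
    ∀ u v : ℝ,
      solMetric (F u v) (Fu u v) (Fu u v) = 1 ∧
      solMetric (F u v) (Fu u v) (Fv u v) = 0 ∧
      solMetric (F u v) (Fv u v) (Fv u v) = Real.exp (2 * u * Real.cos θ) ∧
      -(deriv (deriv (fun t : ℝ => Real.sqrt (Real.exp (2 * t * Real.cos θ)))) u) /
          Real.sqrt (Real.exp (2 * u * Real.cos θ))
        = -(Real.cos θ) ^ 2 := by
  intro u v
  have hcos : Real.cos θ ≠ 0 :=
    (Real.cos_pos_of_mem_Ioo ⟨by linarith [hθ.1, Real.pi_pos], hθ.2⟩).ne'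
  have hu : Fu u v =
      (Real.tan θ * (Real.cos θ * Real.exp (u * Real.cos θ)), 0, -Real.cos θ) := by
    refine (hFu u v).unique ?_
    simp only [hF]
    refine ((hasDerivAt_exp_mul_const _ u).const_mul _).prodMk
      ((hasDerivAt_const u v).prodMk ?_)
    exact (hasDerivAt_mul_const (Real.cos θ)).fun_neg
  have hv : Fv u v = (0, 1, 0) := by
    refine (hFv u v).unique ?_
    simp only [hF]
    exact (hasDerivAt_const v _).prodMk ((hasDerivAt_id v).prodMk (hasDerivAt_const v _))
  have htan : Real.tan θ * Real.cos θ = Real.sin θ := Real.tan_mul_cos hcos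
  refine ⟨?_, ?_, ?_, ?_⟩
  · have hexp : Real.exp (2 * -(u * Real.cos θ)) *
        (Real.exp (u * Real.cos θ) * Real.exp (u * Real.cos θ)) = 1 := by
      rw [← Real.exp_add, ← Real.exp_add, Real.exp_eq_one_iff]
      ring
    simp only [solMetric, hF, hu, ← mul_assoc (Real.tan θ), htan]
    linear_combination Real.sin θ ^ 2 * hexp + Real.sin_sq_add_cos_sq θ
  · simp [solMetric, hu, hv]
  · simp [solMetric, hF, hv, mul_assoc]
  · have hderiv : deriv (fun t : ℝ => Real.exp (t * Real.cos θ)) =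
        fun t => Real.cos θ * Real.exp (t * Real.cos θ) :=
      funext fun t => (hasDerivAt_exp_mul_const _ t).deriv
    simp only [sqrt_exp_two_mul_mul, hderiv]
    rw [((hasDerivAt_exp_mul_const (Real.cos θ) u).const_mul (Real.cos θ)).deriv]
    field_simp
end

section
/- Fix θ ∈ (0, π/2) and ψ₀ ∈ ℝ, set ū(u) = 2u cos θ + ψ₀, sin α(u) = tanh(ū(u)) and cos α(u) = 1/cosh(ū(u)). On any interval where sinh(ū(u)) ≠ 0, the function p(u) = 1/(cos θ · sinh(ū(u))) satisfies the Riccati equation p'(u) + cos α(u) + p(u) cos θ sin α(u) + 2 p(u)² cos²θ cos α(u) = 0. -/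
open Real

/-- For `θ ∈ (0, π/2)`, `ψ₀ ∈ ℝ`, `ū(u) = 2u cos θ + ψ₀`, `sin α(u) = tanh ū(u)` and
`cos α(u) = 1/cosh ū(u)`, wherever `sinh ū(u) ≠ 0` the function
`p(u) = 1/(cos θ · sinh ū(u))` satisfies the Riccati equation
`p' + cos α + p cos θ sin α + 2p² cos²θ cos α = 0`. -/
theorem sol_riccati_special_solution (θ ψ₀ : ℝ) (hθ : θ ∈ Set.Ioo 0 (Real.pi / 2))
    (ubar sinα cosα p : ℝ → ℝ)
    (hubar : ∀ u, ubar u = 2 * u * Real.cos θ + ψ₀)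
    (hsin : ∀ u, sinα u = Real.tanh (ubar u))
    (hcos : ∀ u, cosα u = 1 / Real.cosh (ubar u))
    (hp : ∀ u, p u = 1 / (Real.cos θ * Real.sinh (ubar u))) :
    ∀ u : ℝ, Real.sinh (ubar u) ≠ 0 →
      HasDerivAt p
        (-(cosα u + p u * Real.cos θ * sinα u +
            2 * (p u) ^ 2 * (Real.cos θ) ^ 2 * cosα u)) u := by
  intro u hu
  have hc : Real.cos θ ≠ 0 :=
    (Real.cos_pos_of_mem_Ioo ⟨by linarith [hθ.1, Real.pi_pos], hθ.2⟩).ne'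
  have hch : Real.cosh (ubar u) ≠ 0 := (Real.cosh_pos _).ne'
  have hub : HasDerivAt ubar (2 * Real.cos θ) u := by
    rw [funext hubar]
    simpa using (((hasDerivAt_id u).const_mul 2).mul_const (Real.cos θ)).add_const ψ₀
  have hd := (hub.sinh.const_mul (Real.cos θ)).fun_inv (mul_ne_zero hc hu)
  have hpf : p = fun v => (Real.cos θ * Real.sinh (ubar v))⁻¹ :=
    funext fun v => by rw [hp v, one_div]
  rw [← hpf] at hd
  refine hd.congr_deriv ?_
  rw [hp, hsin, hcos, Real.tanh_eq_sinh_div_cosh]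
  field_simp
  rw [Real.cosh_sq]
  ring
end

section
/- Fix θ ∈ (0, π/2), ψ₀ ∈ ℝ and a constant Λ ∈ ℝ; set ū(u) = 2u cos θ + ψ₀, sin α(u) = tanh(ū(u)), cos α(u) = 1/cosh(ū(u)), and let I be an antiderivative of u ↦ √(cosh(ū(u))). On any interval where cos θ · sinh(ū(u)) + cosh(ū(u))^{3/2}/(Λ - I(u)) ≠ 0 and Λ - I(u) ≠ 0, the function p(u) = 1/(cos θ · sinh(ū(u)) + cosh(ū(u))^{3/2}/(Λ - I(u))) satisfies the Riccati equation p'(u) + cos α(u) + p(u) cos θ sin α(u) + 2 p(u)² cos²θ cos α(u) = 0. -/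
open Real

/-- For `θ ∈ (0, π/2)`, `ψ₀, Λ ∈ ℝ`, `ū(u) = 2u cos θ + ψ₀`, `sin α = tanh ū`,
`cos α = 1/cosh ū` and `I` an antiderivative of `√(cosh ū)`, wherever
`cos θ · sinh ū + cosh^{3/2} ū/(Λ - I) ≠ 0` and `Λ - I ≠ 0`, the function
`p = 1/(cos θ · sinh ū + cosh^{3/2} ū/(Λ - I))` satisfies the Riccati equation
`p' + cos α + p cos θ sin α + 2p² cos²θ cos α = 0`. -/
theorem sol_riccati_general_solution (θ ψ₀ Λ : ℝ) (hθ : θ ∈ Set.Ioo 0 (Real.pi / 2))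
    (ubar sinα cosα I p : ℝ → ℝ)
    (hubar : ∀ u, ubar u = 2 * u * Real.cos θ + ψ₀)
    (hsin : ∀ u, sinα u = Real.tanh (ubar u))
    (hcos : ∀ u, cosα u = 1 / Real.cosh (ubar u))
    (hI : ∀ u, HasDerivAt I (Real.sqrt (Real.cosh (ubar u))) u)
    (hp : ∀ u, p u = 1 / (Real.cos θ * Real.sinh (ubar u) +
        (Real.cosh (ubar u)) ^ ((3 : ℝ) / 2) / (Λ - I u))) :
    ∀ u : ℝ,
      Λ - I u ≠ 0 →
      Real.cos θ * Real.sinh (ubar u) +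
          (Real.cosh (ubar u)) ^ ((3 : ℝ) / 2) / (Λ - I u) ≠ 0 →
      HasDerivAt p
        (-(cosα u + p u * Real.cos θ * sinα u +
            2 * (p u) ^ 2 * (Real.cos θ) ^ 2 * cosα u)) u := by
  intro u hL hD
  have hC : 0 < Real.cosh (ubar u) := Real.cosh_pos _
  have hrpow : Real.cosh (ubar u) ^ ((3 : ℝ) / 2) =
      Real.cosh (ubar u) * √(Real.cosh (ubar u)) := by
    rw [Real.sqrt_eq_rpow, show (3 : ℝ) / 2 = 1 + 1 / 2 by norm_num, Real.rpow_add hC,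
      Real.rpow_one]
  have hu : HasDerivAt ubar (2 * Real.cos θ) u := by
    rw [funext hubar]
    simpa using (((hasDerivAt_id u).const_mul 2).mul_const (Real.cos θ)).add_const ψ₀
  have hk := hu.cosh.rpow_const (p := (3 : ℝ) / 2) (Or.inl hC.ne')
  have hder := (((hu.sinh.const_mul (Real.cos θ)).add
    (hk.div ((hI u).const_sub Λ) hL)).inv hD)
  have hp' : p = (fun v => Real.cos θ * Real.sinh (ubar v) +
      Real.cosh (ubar v) ^ ((3 : ℝ) / 2) / (Λ - I v))⁻¹ := by
    funext v
    simp [hp v]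
  rw [hp u, hsin, hcos, Real.tanh_eq_sinh_div_cosh, hp']
  refine hder.congr_deriv ?_
  simp only [Pi.add_apply, Pi.div_apply]
  rw [show (3 : ℝ) / 2 - 1 = 1 / 2 by norm_num, ← Real.sqrt_eq_rpow]
  rw [hrpow] at hD ⊢
  have hS := Real.cosh_sq (ubar u)
  generalize √(Real.cosh (ubar u)) = s at *
  generalize Real.cosh (ubar u) = C at *
  generalize Real.sinh (ubar u) = S at *
  generalize Real.cos θ = c at *
  generalize Λ - I u = L at *
  obtain ⟨D, hDdef⟩ : ∃ D, D = c * S + C * s / L := ⟨_, rfl⟩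
  rw [← hDdef] at hD ⊢
  have hDL : C * s = (D - c * S) * L := by
    rw [hDdef]
    field_simp
    ring
  have hC0 := hC.ne'
  field_simp
  linear_combination (-2 * c ^ 2 * L ^ 2) * hS -
    (3 * c * S * L + C * s + (D - c * S) * L) * hDL
end

section
/- Fix θ ∈ (0, π/2) and ψ₀ ∈ ℝ; set ū(u) = 2u cos θ + ψ₀, sin α(u) = tanh(ū(u)), cos α(u) = 1/cosh(ū(u)). Let q be a differentiable function on an interval satisfying q'(u) = q(u)² cos α(u) + q(u) cos θ sin α(u) + 2 cos²θ cos α(u), and define B(u) = (q(u) - cos θ · sinh(ū(u))) · cosh(ū(u))^{-3/2}. Then B satisfies B'(u) = B(u)² · √(cosh(ū(u))). -/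
open Real

/-- Appendix reduction: for `θ ∈ (0, π/2)`, `ψ₀ ∈ ℝ`, `ū = 2u cos θ + ψ₀`,
`sin α = tanh ū`, `cos α = 1/cosh ū`, if `q` is differentiable on an interval with
`q' = q² cos α + q cos θ sin α + 2 cos²θ cos α`, then
`B = (q - cos θ sinh ū) · cosh^{-3/2} ū` satisfies `B' = B² √(cosh ū)`. -/
theorem sol_riccati_reduction (θ ψ₀ a b : ℝ) (hθ : θ ∈ Set.Ioo 0 (Real.pi / 2))
    (ubar sinα cosα q B : ℝ → ℝ)
    (hubar : ∀ u, ubar u = 2 * u * Real.cos θ + ψ₀)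
    (hsin : ∀ u, sinα u = Real.tanh (ubar u))
    (hcos : ∀ u, cosα u = 1 / Real.cosh (ubar u))
    (hq : ∀ u ∈ Set.Ioo a b,
      HasDerivAt q
        ((q u) ^ 2 * cosα u + q u * Real.cos θ * sinα u +
          2 * (Real.cos θ) ^ 2 * cosα u) u)
    (hB : ∀ u, B u = (q u - Real.cos θ * Real.sinh (ubar u)) *
        (Real.cosh (ubar u)) ^ (-(3 : ℝ) / 2)) :
    ∀ u ∈ Set.Ioo a b,
      HasDerivAt B ((B u) ^ 2 * Real.sqrt (Real.cosh (ubar u))) u := by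
  intro u hu
  have hC : 0 < Real.cosh (ubar u) := Real.cosh_pos _
  have hu' : HasDerivAt ubar (2 * Real.cos θ) u := by
    rw [funext hubar]
    simpa using (((hasDerivAt_id u).const_mul 2).mul_const (Real.cos θ)).add_const ψ₀
  have hd := ((hq u hu).sub (hu'.sinh.const_mul (Real.cos θ))).mul
    (hu'.cosh.rpow_const (p := -(3 : ℝ) / 2) (Or.inl hC.ne'))
  have hB' : B = fun u => (q u - Real.cos θ * Real.sinh (ubar u)) *
      (Real.cosh (ubar u)) ^ (-(3 : ℝ) / 2) := funext hB
  have hpow : (Real.cosh (ubar u)) ^ (-(3 : ℝ) / 2) = (Real.sqrt (Real.cosh (ubar u)) ^ 3)⁻¹ := by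
    rw [Real.sqrt_eq_rpow, ← Real.rpow_natCast, ← Real.rpow_mul hC.le, ← Real.rpow_neg hC.le]
    norm_num
  rw [hB']
  refine hd.congr_deriv ?_
  simp only [Pi.sub_apply]
  rw [Real.rpow_sub_one hC.ne', hpow, hsin, hcos, Real.tanh_eq_sinh_div_cosh]
  have hs : 0 < Real.sqrt (Real.cosh (ubar u)) := Real.sqrt_pos.mpr hC
  have hsq : Real.cosh (ubar u) = Real.sqrt (Real.cosh (ubar u)) ^ 2 := (Real.sq_sqrt hC.le).symm
  have hCS : Real.cosh (ubar u) ^ 2 = Real.sinh (ubar u) ^ 2 + 1 := Real.cosh_sq _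
  set s := Real.sqrt (Real.cosh (ubar u))
  rw [hsq] at hCS ⊢
  field_simp
  linear_combination (-2 * Real.cos θ ^ 2) * hCS
end

section
/- Fix θ ∈ (0, π/2) and ψ₀ ∈ ℝ; set ū(u) = 2u cos θ + ψ₀, and let I and J be antiderivatives of u ↦ cosh(ū(u))^{1/2} and u ↦ cosh(ū(u))^{-3/2} respectively. Then the curve γ₂(u) = (sin θ · I(u), cos θ · J(u), -½ log cosh(ū(u))) in Sol₃ is parametrized by arclength: for every u, g_{γ₂(u)}(γ₂'(u), γ₂'(u)) = 1, where g is the Sol metric. -/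
open Real

/-- For `θ ∈ (0, π/2)`, `ψ₀ ∈ ℝ`, `ū(u) = 2u cos θ + ψ₀` and `I`, `J` antiderivatives of
`cosh^{1/2} ū` and `cosh^{-3/2} ū`, the curve
`γ₂(u) = (sin θ·I(u), cos θ·J(u), -½ log cosh ū(u))` in Sol₃ is parametrized by
arclength: `g_{γ₂(u)}(γ₂'(u), γ₂'(u)) = 1` for every `u`. -/
theorem sol_gamma2_arclength (θ ψ₀ : ℝ) (hθ : θ ∈ Set.Ioo 0 (Real.pi / 2))
    (ubar I J : ℝ → ℝ)
    (hubar : ∀ u, ubar u = 2 * u * Real.cos θ + ψ₀)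
    (hI : ∀ u, HasDerivAt I ((Real.cosh (ubar u)) ^ ((1 : ℝ) / 2)) u)
    (hJ : ∀ u, HasDerivAt J ((Real.cosh (ubar u)) ^ (-(3 : ℝ) / 2)) u)
    (γ₂ : ℝ → ℝ × ℝ × ℝ)
    (hγ₂ : ∀ u, γ₂ u = (Real.sin θ * I u, Real.cos θ * J u,
        -(1 / 2) * Real.log (Real.cosh (ubar u)))) :
    ∀ u : ℝ, ∃ d : ℝ × ℝ × ℝ,
      HasDerivAt γ₂ d u ∧ solMetric (γ₂ u) d d = 1 := by
  intro u
  have hc : 0 < Real.cosh (ubar u) := Real.cosh_pos _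
  have hub : HasDerivAt ubar (2 * Real.cos θ) u := by
    rw [funext hubar]
    simpa using (((hasDerivAt_id u).const_mul 2).mul_const (Real.cos θ)).add_const ψ₀
  have hlog := (hub.cosh.log hc.ne').const_mul (-(1 / 2) : ℝ)
  have hhalf : (Real.cosh (ubar u) ^ ((1 : ℝ) / 2)) ^ 2 = Real.cosh (ubar u) := by
    rw [← Real.rpow_mul_natCast hc.le]
    norm_num
  have hthree : (Real.cosh (ubar u) ^ (-(3 : ℝ) / 2)) ^ 2 = (Real.cosh (ubar u) ^ 3)⁻¹ := by
    rw [← Real.rpow_mul_natCast hc.le, ← Real.rpow_natCast _ 3, ← Real.rpow_neg hc.le]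
    norm_num
  have hexp : Real.exp (2 * (-(1 / 2) * Real.log (Real.cosh (ubar u)))) =
      (Real.cosh (ubar u))⁻¹ := by
    rw [show 2 * (-(1 / 2) * Real.log (Real.cosh (ubar u))) = -Real.log (Real.cosh (ubar u)) by
      ring, Real.exp_neg, Real.exp_log hc]
  have hderiv :=
    ((hI u).const_mul (Real.sin θ)).prodMk (((hJ u).const_mul (Real.cos θ)).prodMk hlog)
  refine ⟨_, hderiv.congr_of_eventuallyEq (.of_forall hγ₂), ?_⟩
  rw [hγ₂ u]
  simp only [solMetric]
  rw [Real.exp_neg, hexp, inv_inv]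
  set c := Real.cosh (ubar u) with hcdef
  have hsinh : Real.sinh (ubar u) ^ 2 = c ^ 2 - 1 := Real.sinh_sq _
  calc
    _ = c⁻¹ * Real.sin θ ^ 2 * (c ^ ((1 : ℝ) / 2)) ^ 2 +
        c * Real.cos θ ^ 2 * (c ^ (-(3 : ℝ) / 2)) ^ 2 +
        Real.cos θ ^ 2 * Real.sinh (ubar u) ^ 2 / c ^ 2 := by ring
    _ = Real.sin θ ^ 2 + Real.cos θ ^ 2 := by
      rw [hhalf, hthree, hsinh]
      field_simp
      ring
    _ = 1 := Real.sin_sq_add_cos_sq θ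
end

section
/- Fix θ ∈ (0, π/2) and ψ₀ ∈ ℝ; set ū(u) = 2u cos θ + ψ₀, sin α(u) = tanh(ū(u)), cos α(u) = 1/cosh(ū(u)). Let ζ, ξ : ℝ → ℝ be continuous with ζ differentiable, let I, J be antiderivatives of cosh(ū)^{1/2} and cosh(ū)^{-3/2} chosen so that cos θ·(I(u)+J(u)) = sinh(ū(u))/√(cosh(ū(u))) for all u, and define γ₁(v) = (sin θ ∫₀ᵛ ξ(τ)e^{-ζ(τ)}dτ, cos θ ∫₀ᵛ ξ(τ)e^{ζ(τ)}dτ, ζ(v)), γ₂(u) = (sin θ·I(u), cos θ·J(u), -½ log cosh(ū(u))), and F(u,v) = γ₁(v) ∗ γ₂(u) using the Sol group operation. Then the vector N(u,v) = (cos θ·e^{-F₃(u,v)}, -sin θ cos α(u)·e^{F₃(u,v)}, sin θ sin α(u)), where F₃(u,v) = ζ(v) - ½ log cosh(ū(u)), is a unit vector with respect to the Sol metric g at F(u,v), it is orthogonal to both ∂F/∂u and ∂F/∂v, and g(N, e₁(F(u,v))) = cos θ. Hence F parametrizes a constant angle surface in Sol₃ with angle θ. -/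
open Real

/-- The Sol₃ group multiplication on ℝ³. -/
noncomputable def solMul (p q : ℝ × ℝ × ℝ) : ℝ × ℝ × ℝ :=
  (p.1 + Real.exp (-p.2.2) * q.1, p.2.1 + Real.exp p.2.2 * q.2.1, p.2.2 + q.2.2)

/-- `exp (½ log x) = √x` for positive `x`. -/
theorem exp_half_mul_log {x : ℝ} (hx : 0 < x) :
    Real.exp (1 / 2 * Real.log x) = Real.sqrt x := by
  rw [Real.sqrt_eq_rpow, Real.rpow_def_of_pos hx, mul_comm]

theorem rpow_neg_three_halves {x : ℝ} (hx : 0 < x) :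
    x ^ (-(3 : ℝ) / 2) = (Real.sqrt x ^ 3)⁻¹ := by
  rw [neg_div, Real.rpow_neg hx.le, Real.sqrt_eq_rpow, ← Real.rpow_natCast, ← Real.rpow_mul hx.le]
  norm_num

/-- Components of a derivative in a threefold product. -/
theorem HasDerivAt.components {f : ℝ → ℝ × ℝ × ℝ} {f' : ℝ × ℝ × ℝ} {t : ℝ}
    (h : HasDerivAt f f' t) :
    HasDerivAt (fun s => (f s).1) f'.1 t ∧ HasDerivAt (fun s => (f s).2.1) f'.2.1 t ∧
      HasDerivAt (fun s => (f s).2.2) f'.2.2 t := by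
  have h₂ : HasDerivAt (fun s => (f s).2) f'.2 t :=
    h.hasFDerivAt.snd.hasDerivAt.congr_deriv (by simp)
  exact ⟨h.hasFDerivAt.fst.hasDerivAt.congr_deriv (by simp),
    h₂.hasFDerivAt.fst.hasDerivAt.congr_deriv (by simp),
    h₂.hasFDerivAt.snd.hasDerivAt.congr_deriv (by simp)⟩

/-- The general constant angle surface `F(u,v) = γ₁(v) ∗ γ₂(u)` in Sol₃, where
`γ₁(v) = (sin θ ∫₀ᵛ ξe^{-ζ}, cos θ ∫₀ᵛ ξe^{ζ}, ζ(v))` and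
`γ₂(u) = (sin θ·I(u), cos θ·J(u), -½ log cosh ū(u))`, has unit normal
`N(u,v) = (cos θ·e^{-F₃}, -sin θ cos α(u)·e^{F₃}, sin θ sin α(u))` with
`F₃(u,v) = ζ(v) - ½ log cosh ū(u)`: `N` is a unit vector w.r.t. the Sol metric at
`F(u,v)`, it is orthogonal to `∂F/∂u` and `∂F/∂v`, and `g(N, e₁(F(u,v))) = cos θ`.
Hence `F` parametrizes a constant angle surface in Sol₃ with angle `θ`. -/
theorem sol_general_constant_angle_surface (θ ψ₀ : ℝ) (hθ : θ ∈ Set.Ioo 0 (Real.pi / 2))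
    (ubar sinα cosα : ℝ → ℝ)
    (hubar : ∀ u, ubar u = 2 * u * Real.cos θ + ψ₀)
    (hsin : ∀ u, sinα u = Real.tanh (ubar u))
    (hcos : ∀ u, cosα u = 1 / Real.cosh (ubar u))
    (ζ ξ : ℝ → ℝ) (hζ : Differentiable ℝ ζ) (hζc : Continuous ζ) (hξ : Continuous ξ)
    (I J : ℝ → ℝ)
    (hI : ∀ u, HasDerivAt I ((Real.cosh (ubar u)) ^ ((1 : ℝ) / 2)) u)
    (hJ : ∀ u, HasDerivAt J ((Real.cosh (ubar u)) ^ (-(3 : ℝ) / 2)) u)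
    (hIJ : ∀ u, Real.cos θ * (I u + J u)
        = Real.sinh (ubar u) / Real.sqrt (Real.cosh (ubar u)))
    (γ₁ γ₂ : ℝ → ℝ × ℝ × ℝ) (F : ℝ → ℝ → ℝ × ℝ × ℝ) (F₃ : ℝ → ℝ → ℝ)
    (hγ₁ : ∀ v, γ₁ v =
      (Real.sin θ * ∫ τ in (0:ℝ)..v, ξ τ * Real.exp (-(ζ τ)),
       Real.cos θ * ∫ τ in (0:ℝ)..v, ξ τ * Real.exp (ζ τ),
       ζ v))
    (hγ₂ : ∀ u, γ₂ u = (Real.sin θ * I u, Real.cos θ * J u,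
        -(1 / 2) * Real.log (Real.cosh (ubar u))))
    (hF : ∀ u v, F u v = solMul (γ₁ v) (γ₂ u))
    (hF₃ : ∀ u v, F₃ u v = ζ v - (1 / 2) * Real.log (Real.cosh (ubar u)))
    (N : ℝ → ℝ → ℝ × ℝ × ℝ)
    (hN : ∀ u v, N u v =
      (Real.cos θ * Real.exp (-(F₃ u v)),
       -(Real.sin θ) * cosα u * Real.exp (F₃ u v),
       Real.sin θ * sinα u)) :
    ∀ u v : ℝ, ∀ du dv : ℝ × ℝ × ℝ,
      HasDerivAt (fun t => F t v) du u →
      HasDerivAt (fun t => F u t) dv v →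
      solMetric (F u v) (N u v) (N u v) = 1 ∧
      solMetric (F u v) (N u v) du = 0 ∧
      solMetric (F u v) (N u v) dv = 0 ∧
      solMetric (F u v) (N u v) (solE1 (F u v)) = Real.cos θ := by
  intro u v du dv hdu hdv
  have hc : 0 < Real.cosh (ubar u) := Real.cosh_pos _
  have hr : 0 < Real.sqrt (Real.cosh (ubar u)) := Real.sqrt_pos.2 hc
  have hrc : Real.sqrt (Real.cosh (ubar u)) ^ 2 = Real.cosh (ubar u) := Real.sq_sqrt hc.le
  have hE : 0 < Real.exp (ζ v) := Real.exp_pos _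
  have hub : HasDerivAt ubar (2 * Real.cos θ) u := by
    rw [funext hubar]
    simpa using (((hasDerivAt_id u).const_mul 2).mul_const (Real.cos θ)).add_const ψ₀
  have hFe : ∀ s t, F s t =
      (Real.sin θ * (∫ τ in (0:ℝ)..t, ξ τ * Real.exp (-(ζ τ)))
          + Real.exp (-ζ t) * (Real.sin θ * I s),
       Real.cos θ * (∫ τ in (0:ℝ)..t, ξ τ * Real.exp (ζ τ))
          + Real.exp (ζ t) * (Real.cos θ * J s),
       ζ t + -(1 / 2) * Real.log (Real.cosh (ubar s))) := fun s t => by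
    rw [hF, hγ₁, hγ₂, solMul]
  have hz : (F u v).2.2 = F₃ u v := by rw [hFe, hF₃]; ring
  have hexp : Real.exp (F₃ u v) = Real.exp (ζ v) / Real.sqrt (Real.cosh (ubar u)) := by
    rw [hF₃, Real.exp_sub, exp_half_mul_log hc]
  obtain ⟨a₁, a₂, a₃⟩ := hdu.components
  obtain ⟨b₁, b₂, b₃⟩ := hdv.components
  simp only [hFe] at a₁ a₂ a₃ b₁ b₂ b₃
  have hd₁ := a₁.unique ((((hI u).const_mul (Real.sin θ)).const_mul (Real.exp (-ζ v))).const_add _)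
  have hd₂ := a₂.unique ((((hJ u).const_mul (Real.cos θ)).const_mul (Real.exp (ζ v))).const_add _)
  have hd₃ := a₃.unique (((hub.cosh.log hc.ne').const_mul (-(1 / 2))).const_add (ζ v))
  have hζv := (hζ v).hasDerivAt
  have int₁ : HasDerivAt (fun t => ∫ τ in (0:ℝ)..t, ξ τ * Real.exp (-(ζ τ)))
      (ξ v * Real.exp (-(ζ v))) v :=
    ((hξ.mul hζc.neg.rexp).integral_hasStrictDerivAt 0 v).hasDerivAt
  have int₂ : HasDerivAt (fun t => ∫ τ in (0:ℝ)..t, ξ τ * Real.exp (ζ τ))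
      (ξ v * Real.exp (ζ v)) v :=
    ((hξ.mul hζc.rexp).integral_hasStrictDerivAt 0 v).hasDerivAt
  have he₁ := b₁.unique ((int₁.const_mul (Real.sin θ)).add (hζv.neg.exp.mul_const _))
  have he₂ := b₂.unique ((int₂.const_mul (Real.cos θ)).add (hζv.exp.mul_const _))
  have he₃ := b₃.unique (hζv.add_const _)
  rw [← Real.sqrt_eq_rpow] at hd₁
  rw [rpow_neg_three_halves hc] at hd₂
  have hIJu := hIJ u
  have hcs := Real.cosh_sq (ubar u)
  have hsc := Real.sin_sq_add_cos_sq θ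
  simp only [Pi.neg_apply] at he₁
  simp only [solMetric, solE1, hz, hN, hsin, hcos, Real.tanh_eq_sinh_div_cosh, hd₁, hd₂, hd₃,
    he₁, he₂, he₃, two_mul (F₃ u v), Real.exp_neg, Real.exp_add, hexp]
  generalize Real.sqrt (Real.cosh (ubar u)) = r at *
  generalize Real.exp (ζ v) = E at *
  rw [← hrc] at hcs ⊢
  generalize Real.sinh (ubar u) = σ at *
  generalize Real.cos θ = C at *
  generalize Real.sin θ = S at *
  have hI' : C * (I u + J u) * r = σ := by rw [hIJu]; field_simp
  refine ⟨?_, ?_, ?_, ?_⟩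
  · field_simp
    linear_combination r ^ 4 * hsc - S ^ 2 * hcs
  · field_simp
    linear_combination C * S * hcs
  · rw [← hI']
    field_simp
    ring
  · field_simp
    ring
end

section
/- Fix θ ∈ (0, π/2) and ψ₀ ∈ ℝ; set ū(u) = 2u cos θ + ψ₀, sin α(u) = tanh(ū(u)), cos α(u) = 1/cosh(ū(u)). Let p be a differentiable function on an interval satisfying the Riccati equation p'(u) + cos α(u) + p(u) cos θ sin α(u) + 2 p(u)² cos²θ cos α(u) = 0, and define σ(u) = sin θ sin α(u) + 2 p(u) sin θ cos θ cos α(u). Then σ satisfies σ'(u) + cot θ · (σ(u) + 2 sin α(u) sin θ) · (σ(u) - sin α(u) sin θ) = 0. -/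
open Real

/-- For `θ ∈ (0, π/2)`, `ψ₀ ∈ ℝ`, `ū = 2u cos θ + ψ₀`, `sin α = tanh ū`,
`cos α = 1/cosh ū`: if `p` is differentiable on an interval with
`p' + cos α + p cos θ sin α + 2p² cos²θ cos α = 0`, then
`σ = sin θ sin α + 2p sin θ cos θ cos α` satisfies
`σ' + cot θ·(σ + 2 sin α sin θ)·(σ - sin α sin θ) = 0`. -/
theorem sol_sigma_equation (θ ψ₀ a b : ℝ) (hθ : θ ∈ Set.Ioo 0 (Real.pi / 2))
    (ubar sinα cosα p σ : ℝ → ℝ)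
    (hubar : ∀ u, ubar u = 2 * u * Real.cos θ + ψ₀)
    (hsin : ∀ u, sinα u = Real.tanh (ubar u))
    (hcos : ∀ u, cosα u = 1 / Real.cosh (ubar u))
    (hp : ∀ u ∈ Set.Ioo a b,
      HasDerivAt p
        (-(cosα u + p u * Real.cos θ * sinα u +
            2 * (p u) ^ 2 * (Real.cos θ) ^ 2 * cosα u)) u)
    (hσ : ∀ u, σ u = Real.sin θ * sinα u +
        2 * p u * Real.sin θ * Real.cos θ * cosα u) :
    ∀ u ∈ Set.Ioo a b,
      HasDerivAt σ
        (-((Real.cos θ / Real.sin θ) * (σ u + 2 * sinα u * Real.sin θ) *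
            (σ u - sinα u * Real.sin θ))) u := by
  intro u hu
  have hs : Real.sin θ ≠ 0 :=
    (Real.sin_pos_of_pos_of_lt_pi hθ.1 (by linarith [hθ.2, Real.pi_pos])).ne'
  have hch : Real.cosh (ubar u) ≠ 0 := (Real.cosh_pos _).ne'
  have hu' : HasDerivAt ubar (2 * Real.cos θ) u := by
    rw [funext hubar]
    simpa using (((hasDerivAt_id u).const_mul 2).mul_const (Real.cos θ)).add_const ψ₀
  have hsin' : HasDerivAt sinα (2 * Real.cos θ * cosα u ^ 2) u := by
    have h := hu'.sinh.div hu'.cosh hch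
    have heq : sinα = fun x => Real.sinh (ubar x) / Real.cosh (ubar x) := by
      funext x
      rw [hsin, Real.tanh_eq_sinh_div_cosh]
    rw [heq]
    refine h.congr_deriv ?_
    rw [hcos]
    field_simp
    linear_combination Real.cos θ * Real.cosh_sq (ubar u)
  have hcos' : HasDerivAt cosα (-(2 * Real.cos θ * sinα u * cosα u)) u := by
    have h := hu'.cosh.inv hch
    have heq : cosα = fun x => (Real.cosh (ubar x))⁻¹ := by
      funext x
      rw [hcos, one_div]
    rw [hsin, heq, Real.tanh_eq_sinh_div_cosh]
    refine h.congr_deriv ?_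
    field_simp
  have h := (hsin'.const_mul (Real.sin θ)).add
    (((((hp u hu).const_mul 2).mul_const (Real.sin θ)).mul_const (Real.cos θ)).mul hcos')
  have hval := hσ u
  rw [hval, funext hσ]
  refine h.congr_deriv ?_
  field_simp
  ring
end
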